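/- arXiv:1709.03043 — 12 statements merged into one kernel-verified Lean document; each statement's English description precedes it below -/
import Mathlib

section
/- Let E be a real inner product space, let G : E → ℝ be convex and differentiable with ∇G Lipschitz continuous with constant L > 0, let h : E → ℝ be convex, and set f := G + h. Then for every α, d ∈ E and every η ∈ [0,1]: f(α + ηd) - f(α) ≤ η·(⟪∇G(α), d⟫ + h(α+d) - h(α)) + (η²·L/2)·‖d‖². -/
open RealInnerProductSpace

/-- The **descent lemma**: a function whose gradient is `L`-Lipschitz lies below its
quadratic upper model. -/
theorem le_add_inner_add_sq_of_lipschitz_gradient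
    {E : Type*} [NormedAddCommGroup E] [InnerProductSpace ℝ E]
    {G : E → ℝ} {G' : E → E} {L : ℝ}
    (hG : ∀ x : E, HasFDerivAt G (InnerProductSpace.toDualMap ℝ E (G' x) : E →L[ℝ] ℝ) x)
    (hG' : ∀ x y : E, ‖G' x - G' y‖ ≤ L * ‖x - y‖) (x v : E) :
    G (x + v) ≤ G x + ⟪G' x, v⟫ + L / 2 * ‖v‖ ^ 2 := by
  have hline (t : ℝ) : HasDerivAt (fun s : ℝ => G (x + s • v)) ⟪G' (x + t • v), v⟫ t := by
    have hv : HasDerivAt (fun s : ℝ => x + s • v) v t := by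
      simpa using ((hasDerivAt_id t).smul_const v).const_add x
    exact (hG (x + t • v)).comp_hasDerivAt t hv
  have hmodel (t : ℝ) : HasDerivAt
      (fun s : ℝ => G x + s * ⟪G' x, v⟫ + L / 2 * ‖v‖ ^ 2 * s ^ 2)
      (⟪G' x, v⟫ + L * ‖v‖ ^ 2 * t) t := by
    refine ((((hasDerivAt_id t).mul_const ⟪G' x, v⟫).const_add (G x)).add
      ((hasDerivAt_pow 2 t).const_mul (L / 2 * ‖v‖ ^ 2))).congr_deriv ?_
    norm_num
    ring
  have hbound : ∀ t ∈ Set.Ico (0 : ℝ) 1,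
      ⟪G' (x + t • v), v⟫ ≤ ⟪G' x, v⟫ + L * ‖v‖ ^ 2 * t := by
    intro t ht
    have hnorm : ‖G' (x + t • v) - G' x‖ ≤ L * (t * ‖v‖) := by
      simpa [norm_smul, abs_of_nonneg ht.1] using hG' (x + t • v) x
    have hinner : ⟪G' (x + t • v), v⟫ - ⟪G' x, v⟫ ≤ L * (t * ‖v‖) * ‖v‖ := by
      rw [← inner_sub_left]
      exact (real_inner_le_norm _ _).trans (mul_le_mul_of_nonneg_right hnorm (norm_nonneg v))
    linarith
  have key := image_le_of_deriv_right_le_deriv_boundary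
    (fun t _ => (hline t).continuousAt.continuousWithinAt)
    (fun t _ => (hline t).hasDerivWithinAt) (by simp)
    (fun t _ => (hmodel t).continuousAt.continuousWithinAt)
    (fun t _ => (hmodel t).hasDerivWithinAt) hbound (Set.right_mem_Icc.2 zero_le_one)
  simpa using key

/-- Per-step upper bound (eq:lipschitz): descent lemma for the smooth part combined with
convexity of the nonsmooth part. -/
theorem stepwise_upper_bound
    {E : Type*} [NormedAddCommGroup E] [InnerProductSpace ℝ E]
    (G h : E → ℝ) (G' : E → E) (L : ℝ) (hL : 0 < L)
    (hGconv : ConvexOn ℝ Set.univ G)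
    (hGdiff : ∀ x : E, HasFDerivAt G ((InnerProductSpace.toDualMap ℝ E (G' x) : E →L[ℝ] ℝ)) x)
    (hGlip : ∀ x y : E, ‖G' x - G' y‖ ≤ L * ‖x - y‖)
    (hhconv : ConvexOn ℝ Set.univ h) :
    ∀ (α d : E) (η : ℝ), η ∈ Set.Icc (0 : ℝ) 1 →
      (G (α + η • d) + h (α + η • d)) - (G α + h α) ≤
        η * (⟪G' α, d⟫ + h (α + d) - h α) + η ^ 2 * L / 2 * ‖d‖ ^ 2 := by
  intro α d η ⟨hη0, hη1⟩
  have hsmooth := le_add_inner_add_sq_of_lipschitz_gradient hGdiff hGlip α (η • d)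
  rw [real_inner_smul_right, norm_smul, Real.norm_of_nonneg hη0, mul_pow] at hsmooth
  have hpoint : (1 - η) • α + η • (α + d) = α + η • d := by module
  have hconv := hhconv.2 (Set.mem_univ α) (Set.mem_univ (α + d)) (sub_nonneg.2 hη1) hη0
    (sub_add_cancel 1 η)
  rw [hpoint, smul_eq_mul, smul_eq_mul] at hconv
  linarith
end

section
/- Let E be a real inner product space, G : E → ℝ convex and differentiable, h : E → ℝ convex, α ∈ E, and B : E → E a continuous linear self-adjoint map. Define Q(d) := ⟪∇G(α), d⟫ + (1/2)·⟪d, B d⟫ + h(α+d). Suppose ⟪d, B d⟫ ≥ C1·‖d‖² for all d ∈ E (C1 ∈ ℝ is allowed to be nonpositive), Q is C2-strongly convex for some C2 > 0, and C1 + C2 > 0. If Δ is a global minimizer of Q over E, then the predicted decrease Δ̂ := ⟪∇G(α), Δ⟫ + h(α+Δ) - h(α) satisfies Δ̂ ≤ -((C1 + C2)/2)·‖Δ‖². -/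
open RealInnerProductSpace

/-- `F` is `C`-strongly convex on a real inner product space. -/
def StrongConvex {E : Type*} [NormedAddCommGroup E] [InnerProductSpace ℝ E]
    (C : ℝ) (F : E → ℝ) : Prop :=
  ∀ x y : E, ∀ l : ℝ, l ∈ Set.Icc (0 : ℝ) 1 →
    F (l • x + (1 - l) • y) ≤ l * F x + (1 - l) * F y - C / 2 * (l * (1 - l)) * ‖x - y‖ ^ 2

/-- A minimizer of a `C`-strongly convex function, `0 ≤ C`, satisfies quadratic growth. -/
theorem StrongConvex.quadratic_growth
    {E : Type*} [NormedAddCommGroup E] [InnerProductSpace ℝ E]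
    {C : ℝ} {F : E → ℝ} (hC : 0 ≤ C) (hF : StrongConvex C F)
    {x : E} (hx : ∀ y : E, F x ≤ F y) (y : E) :
    F x + C / 2 * ‖y - x‖ ^ 2 ≤ F y := by
  refine le_of_forall_pos_le_add fun ε hε => ?_
  have hc : 0 ≤ C / 2 * ‖y - x‖ ^ 2 := by positivity
  set c := C / 2 * ‖y - x‖ ^ 2 with hc_def
  have hcε : 0 < c + ε := by positivity
  set l := ε / (c + ε)
  have hl0 : 0 < l := by positivity
  have hl1 : l ≤ 1 := (div_le_one hcε).2 (by linarith)
  have hl : l * (c + ε) = ε := div_mul_cancel₀ _ hcε.ne'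
  have hsc := (hx _).trans (hF y x l ⟨hl0.le, hl1⟩)
  have hmul : l * (F x + (1 - l) * c) ≤ l * F y := by
    rw [hc_def]
    linarith
  have hdiv := le_of_mul_le_mul_left hmul hl0
  nlinarith [mul_pos hl0 hε]

/-- Descent inequality (eq:descent): the exact minimizer of the quadratic model yields a
predicted decrease of at least `((C1+C2)/2)‖Δ‖²`. -/
theorem exact_model_descent
    {E : Type*} [NormedAddCommGroup E] [InnerProductSpace ℝ E]
    (G h : E → ℝ) (G' : E → E) (α : E) (B : E →L[ℝ] E)
    (hGconv : ConvexOn ℝ Set.univ G)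
    (hGdiff : ∀ x : E, HasFDerivAt G ((InnerProductSpace.toDualMap ℝ E (G' x) : E →L[ℝ] ℝ)) x)
    (hhconv : ConvexOn ℝ Set.univ h)
    (hBsa : ∀ x y : E, ⟪B x, y⟫ = ⟪x, B y⟫)
    (C1 C2 : ℝ) (hC2 : 0 < C2) (hC12 : 0 < C1 + C2)
    (hB : ∀ d : E, C1 * ‖d‖ ^ 2 ≤ ⟪d, B d⟫)
    (Q : E → ℝ)
    (hQ : ∀ d : E, Q d = ⟪G' α, d⟫ + 1 / 2 * ⟪d, B d⟫ + h (α + d))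
    (hQsc : StrongConvex C2 Q)
    (Δ : E) (hΔ : ∀ d : E, Q Δ ≤ Q d) :
    ⟪G' α, Δ⟫ + h (α + Δ) - h α ≤ -((C1 + C2) / 2) * ‖Δ‖ ^ 2 := by
  have hgrowth := hQsc.quadratic_growth hC2.le hΔ 0
  rw [hQ Δ, hQ 0] at hgrowth
  simp only [inner_zero_right, inner_zero_left, add_zero, zero_sub, norm_neg, mul_zero,
    zero_add] at hgrowth
  linarith [hB Δ]
end

section
/- Let E be a real inner product space, let G : E → ℝ be convex and differentiable with ∇G Lipschitz continuous with constant L > 0, let h : E → ℝ be convex, f := G + h, α ∈ E, and B : E → E a continuous linear self-adjoint map. Define Q(d) := ⟪∇G(α), d⟫ + (1/2)·⟪d, B d⟫ + h(α+d). Suppose ⟪d, B d⟫ ≥ C1·‖d‖² for all d, Q is C2-strongly convex with C2 > 0, C1 + C2 > 0, and Δ is a global minimizer of Q. Then for every τ ∈ (0,1) and every η ∈ [0,1] with η ≤ (1-τ)(C1+C2)/L, the Armijo condition holds: f(α + ηΔ) ≤ f(α) + η·τ·Δ̂, where Δ̂ := ⟪∇G(α), Δ⟫ + h(α+Δ) -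 h(α). -/
open RealInnerProductSpace

/-- Descent lemma: a function whose gradient is `L`-Lipschitz lies below its quadratic upper model. -/
theorem le_quadratic_of_lipschitz_gradient
    {E : Type*} [NormedAddCommGroup E] [InnerProductSpace ℝ E]
    {G : E → ℝ} {G' : E → E} {L : ℝ}
    (hGdiff : ∀ x : E, HasFDerivAt G (InnerProductSpace.toDualMap ℝ E (G' x) : E →L[ℝ] ℝ) x)
    (hGlip : ∀ x y : E, ‖G' x - G' y‖ ≤ L * ‖x - y‖) (x d : E) :
    G (x + d) ≤ G x + ⟪G' x, d⟫ + L / 2 * ‖d‖ ^ 2 := by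
  have hderiv (t : ℝ) :
      HasDerivAt (fun t : ℝ => G (x + t • d) - (t * ⟪G' x, d⟫ + L / 2 * ‖d‖ ^ 2 * t ^ 2))
        (⟪G' (x + t • d), d⟫ - (⟪G' x, d⟫ + L * ‖d‖ ^ 2 * t)) t := by
    have hline : HasDerivAt (fun t : ℝ => x + t • d) d t := by
      simpa using ((hasDerivAt_id t).smul_const d).const_add x
    have hG : HasDerivAt (fun t : ℝ => G (x + t • d)) ⟪G' (x + t • d), d⟫ t := by
      have hcomp := (hGdiff (x + t • d)).comp_hasDerivAt t hline
      simpa [Function.comp_def] using hcomp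
    refine hG.sub ((((hasDerivAt_id t).mul_const ⟪G' x, d⟫).add
      ((hasDerivAt_pow 2 t).const_mul (L / 2 * ‖d‖ ^ 2))).congr_deriv ?_)
    norm_num
    ring
  have hanti := antitoneOn_of_deriv_nonpos (convex_Icc (0 : ℝ) 1)
    (fun t _ => (hderiv t).continuousAt.continuousWithinAt)
    (fun t _ => (hderiv t).differentiableAt.differentiableWithinAt)
    (fun t ht => by
      rw [interior_Icc] at ht
      rw [(hderiv t).deriv]
      have hle : ⟪G' (x + t • d) - G' x, d⟫ ≤ L * ‖d‖ ^ 2 * t := by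
        calc ⟪G' (x + t • d) - G' x, d⟫ ≤ ‖G' (x + t • d) - G' x‖ * ‖d‖ :=
              real_inner_le_norm _ _
          _ ≤ L * ‖x + t • d - x‖ * ‖d‖ := by gcongr; exact hGlip _ _
          _ = L * ‖d‖ ^ 2 * t := by
              rw [add_sub_cancel_left, norm_smul, Real.norm_of_nonneg ht.1.le]
              ring
      rw [inner_sub_left] at hle
      linarith)
  have h01 := hanti (Set.left_mem_Icc.2 zero_le_one) (Set.right_mem_Icc.2 zero_le_one) zero_le_one
  norm_num at h01
  linarith

/-- A strongly convex function grows quadratically away from a global minimizer. -/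
theorem StrongConvex.add_sq_norm_le_of_forall_le
    {E : Type*} [NormedAddCommGroup E] [InnerProductSpace ℝ E]
    {C : ℝ} {F : E → ℝ} (hF : StrongConvex C F) {x : E} (hx : ∀ y : E, F x ≤ F y) (y : E) :
    F x + C / 2 * ‖x - y‖ ^ 2 ≤ F y := by
  have hlim : Filter.Tendsto (fun l : ℝ => F x + C / 2 * l * ‖x - y‖ ^ 2)
      (nhdsWithin 1 (Set.Iio 1)) (nhds (F x + C / 2 * 1 * ‖x - y‖ ^ 2)) :=
    (Continuous.tendsto (by fun_prop) 1).mono_left nhdsWithin_le_nhds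
  rw [mul_one] at hlim
  refine le_of_tendsto hlim ?_
  filter_upwards [Ioo_mem_nhdsLT (zero_lt_one (α := ℝ))] with l hl
  have hmin := (hx _).trans (hF x y l ⟨hl.1.le, hl.2.le⟩)
  refine le_of_mul_le_mul_left ?_ (sub_pos.2 hl.2)
  linarith

/-- Sufficient-step-size claim from Lemma 2: any `η ∈ [0,1]` with
`η ≤ (1-τ)(C1+C2)/L` satisfies the Armijo condition. -/
theorem armijo_holds_for_small_step
    {E : Type*} [NormedAddCommGroup E] [InnerProductSpace ℝ E]
    (G h : E → ℝ) (G' : E → E) (L : ℝ) (hL : 0 < L)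
    (hGconv : ConvexOn ℝ Set.univ G)
    (hGdiff : ∀ x : E, HasFDerivAt G ((InnerProductSpace.toDualMap ℝ E (G' x) : E →L[ℝ] ℝ)) x)
    (hGlip : ∀ x y : E, ‖G' x - G' y‖ ≤ L * ‖x - y‖)
    (hhconv : ConvexOn ℝ Set.univ h)
    (f : E → ℝ) (hf : ∀ x : E, f x = G x + h x)
    (α : E) (B : E →L[ℝ] E)
    (hBsa : ∀ x y : E, ⟪B x, y⟫ = ⟪x, B y⟫)
    (C1 C2 : ℝ) (hC2 : 0 < C2) (hC12 : 0 < C1 + C2)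
    (hB : ∀ d : E, C1 * ‖d‖ ^ 2 ≤ ⟪d, B d⟫)
    (Q : E → ℝ)
    (hQ : ∀ d : E, Q d = ⟪G' α, d⟫ + 1 / 2 * ⟪d, B d⟫ + h (α + d))
    (hQsc : StrongConvex C2 Q)
    (Δ : E) (hΔ : ∀ d : E, Q Δ ≤ Q d)
    (Δhat : ℝ) (hΔhat : Δhat = ⟪G' α, Δ⟫ + h (α + Δ) - h α) :
    ∀ τ : ℝ, τ ∈ Set.Ioo (0 : ℝ) 1 →
      ∀ η : ℝ, η ∈ Set.Icc (0 : ℝ) 1 → η ≤ (1 - τ) * (C1 + C2) / L →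
        f (α + η • Δ) ≤ f α + η * τ * Δhat := by
  rintro τ ⟨-, hτ⟩ η ⟨hη0, hη1⟩ hη
  have hdescent := le_quadratic_of_lipschitz_gradient hGdiff hGlip α (η • Δ)
  rw [inner_smul_right, norm_smul, Real.norm_of_nonneg hη0] at hdescent
  have hconv : h (α + η • Δ) ≤ (1 - η) * h α + η * h (α + Δ) := by
    have hseg := hhconv.2 (Set.mem_univ α) (Set.mem_univ (α + Δ)) (sub_nonneg.2 hη1) hη0
      (sub_add_cancel 1 η)
    rwa [show (1 - η) • α + η • (α + Δ) = α + η • Δ by module] at hseg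
  have hdecrease : Δhat ≤ -((C1 + C2) / 2 * ‖Δ‖ ^ 2) := by
    have hgrowth := hQsc.add_sq_norm_le_of_forall_le hΔ 0
    simp only [hQ, sub_zero, inner_zero_left, inner_zero_right, mul_zero, add_zero,
      zero_add] at hgrowth
    linarith [hB Δ]
  have hstep : η * L ≤ (1 - τ) * (C1 + C2) := (le_div_iff₀ hL).1 hη
  have hscaled : η * (1 - τ) * Δhat ≤ η * (1 - τ) * -((C1 + C2) / 2 * ‖Δ‖ ^ 2) :=
    mul_le_mul_of_nonneg_left hdecrease (mul_nonneg hη0 (sub_nonneg.2 hτ.le))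
  have hquad : η / 2 * ‖Δ‖ ^ 2 * (η * L) ≤ η / 2 * ‖Δ‖ ^ 2 * ((1 - τ) * (C1 + C2)) :=
    mul_le_mul_of_nonneg_left hstep (by positivity)
  rw [hf, hf]
  subst hΔhat
  linarith
end

section
/- Under the hypotheses of the sufficient-step-size claim (G convex differentiable with L-Lipschitz gradient, h convex, f = G + h, ⟪d, B d⟫ ≥ C1·‖d‖² for all d, Q C2-strongly convex with C2 > 0, C1 + C2 > 0, Δ a global minimizer of Q, τ ∈ (0,1)), for every β ∈ (0,1) the set of nonnegative integers i such that η = βⁱ satisfies the Armijo condition f(α + ηΔ) ≤ f(α) + η·τ·Δ̂ is nonempty, and its least element i₀ satisfies β^{i₀} ≥ min(1, β·(1-τ)(C1+C2)/L). -/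
open RealInnerProductSpace

/-- Descent lemma: the quadratic upper bound for a function with `L`-Lipschitz gradient. -/
theorem le_add_inner_add_of_lipschitz_gradient
    {E : Type*} [NormedAddCommGroup E] [InnerProductSpace ℝ E]
    {G : E → ℝ} {G' : E → E} {L : ℝ}
    (hGdiff : ∀ x : E, HasFDerivAt G ((InnerProductSpace.toDualMap ℝ E (G' x) : E →L[ℝ] ℝ)) x)
    (hGlip : ∀ x y : E, ‖G' x - G' y‖ ≤ L * ‖x - y‖) (x d : E) :
    G (x + d) ≤ G x + ⟪G' x, d⟫ + L / 2 * ‖d‖ ^ 2 := by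
  have hline (t : ℝ) : HasDerivAt (fun t : ℝ => x + t • d) d t := by
    simpa using ((hasDerivAt_id t).smul_const d).const_add x
  have hder (t : ℝ) : HasDerivAt
      (fun t : ℝ => G (x + t • d) - t * ⟪G' x, d⟫ - L / 2 * ‖d‖ ^ 2 * t ^ 2)
      (⟪G' (x + t • d), d⟫ - ⟪G' x, d⟫ - L * ‖d‖ ^ 2 * t) t := by
    have h1 : HasDerivAt (fun t : ℝ => G (x + t • d)) ⟪G' (x + t • d), d⟫ t := by
      simpa [Function.comp_def] using (hGdiff (x + t • d)).comp_hasDerivAt t (hline t)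
    have h2 : HasDerivAt (fun t : ℝ => t * ⟪G' x, d⟫) ⟪G' x, d⟫ t := by
      simpa using (hasDerivAt_id t).mul_const ⟪G' x, d⟫
    have h3 : HasDerivAt (fun t : ℝ => L / 2 * ‖d‖ ^ 2 * t ^ 2) (L * ‖d‖ ^ 2 * t) t := by
      refine ((hasDerivAt_pow 2 t).const_mul (L / 2 * ‖d‖ ^ 2)).congr_deriv ?_
      push_cast
      ring
    exact (h1.sub h2).sub h3
  have hanti : AntitoneOn
      (fun t : ℝ => G (x + t • d) - t * ⟪G' x, d⟫ - L / 2 * ‖d‖ ^ 2 * t ^ 2)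
      (Set.Icc 0 1) := by
    refine antitoneOn_of_deriv_nonpos (convex_Icc 0 1)
      (fun t _ => (hder t).continuousAt.continuousWithinAt)
      (fun t _ => (hder t).differentiableAt.differentiableWithinAt) fun t ht => ?_
    rw [interior_Icc] at ht
    rw [(hder t).deriv, ← inner_sub_left]
    have hcs := real_inner_le_norm (G' (x + t • d) - G' x) d
    have hlip := hGlip (x + t • d) x
    rw [add_sub_cancel_left, norm_smul, Real.norm_of_nonneg ht.1.le] at hlip
    nlinarith [mul_le_mul_of_nonneg_right hlip (norm_nonneg d)]
  have h01 := hanti (Set.left_mem_Icc.2 zero_le_one) (Set.right_mem_Icc.2 zero_le_one) zero_le_one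
  simp only [one_smul, zero_smul, add_zero] at h01
  linarith

/-- Quadratic growth of a strongly convex function away from a global minimizer. -/
theorem StrongConvex.add_sq_le_of_forall_le
    {E : Type*} [NormedAddCommGroup E] [InnerProductSpace ℝ E]
    {C : ℝ} {F : E → ℝ} (hF : StrongConvex C F) {x : E} (hx : ∀ y, F x ≤ F y) (y : E) :
    F x + C / 2 * ‖y - x‖ ^ 2 ≤ F y := by
  set K := C / 2 * ‖y - x‖ ^ 2 with hK
  by_contra! hlt
  have hKpos : 0 < K := by linarith [hx y]
  have hl0 : 0 < (F x + K - F y) / (2 * K) := div_pos (by linarith) (by linarith)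
  have hl1 : (F x + K - F y) / (2 * K) ≤ 1 := by
    rw [div_le_one (by linarith)]
    linarith [hx y]
  have hlK : (F x + K - F y) / (2 * K) * K = (F x + K - F y) / 2 := by
    field_simp
  set l := (F x + K - F y) / (2 * K)
  have hconv := (hx _).trans (hF y x l ⟨hl0.le, hl1⟩)
  have hfactor : l * (F x - F y + K - l * K) ≤ 0 := by
    rw [hK]
    linarith
  nlinarith

/-- A sufficiently small step along the minimizer of the regularized quadratic model
satisfies the Armijo condition. -/
theorem armijo_of_le
    {E : Type*} [NormedAddCommGroup E] [InnerProductSpace ℝ E]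
    {G h : E → ℝ} {G' : E → E} {L : ℝ} (hL : 0 < L)
    (hGdiff : ∀ x : E, HasFDerivAt G ((InnerProductSpace.toDualMap ℝ E (G' x) : E →L[ℝ] ℝ)) x)
    (hGlip : ∀ x y : E, ‖G' x - G' y‖ ≤ L * ‖x - y‖)
    (hhconv : ConvexOn ℝ Set.univ h) {α Δ : E} {B : E →L[ℝ] E} {C1 C2 : ℝ}
    (hB : C1 * ‖Δ‖ ^ 2 ≤ ⟪Δ, B Δ⟫)
    (hQsc : StrongConvex C2 fun d => ⟪G' α, d⟫ + 1 / 2 * ⟪d, B d⟫ + h (α + d))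
    (hΔ : ∀ d : E, ⟪G' α, Δ⟫ + 1 / 2 * ⟪Δ, B Δ⟫ + h (α + Δ) ≤
      ⟪G' α, d⟫ + 1 / 2 * ⟪d, B d⟫ + h (α + d))
    {τ η : ℝ} (hτ : τ ≤ 1) (hη0 : 0 ≤ η) (hη1 : η ≤ 1)
    (hη : η ≤ (1 - τ) * (C1 + C2) / L) :
    G (α + η • Δ) + h (α + η • Δ) ≤
      G α + h α + η * τ * (⟪G' α, Δ⟫ + h (α + Δ) - h α) := by
  have hgrowth := hQsc.add_sq_le_of_forall_le hΔ 0
  simp only [inner_zero_right, inner_zero_left, add_zero, zero_sub, norm_neg, mul_zero,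
    zero_add] at hgrowth
  have hdecr : (C1 + C2) / 2 * ‖Δ‖ ^ 2 ≤ -(⟪G' α, Δ⟫ + h (α + Δ) - h α) := by linarith
  have hdesc := le_add_inner_add_of_lipschitz_gradient hGdiff hGlip α (η • Δ)
  rw [inner_smul_right, norm_smul, Real.norm_of_nonneg hη0] at hdesc
  have hh := hhconv.2 (Set.mem_univ α) (Set.mem_univ (α + Δ)) (sub_nonneg.2 hη1) hη0
    (sub_add_cancel 1 η)
  have hpt : (1 - η) • α + η • (α + Δ) = α + η • Δ := by module
  rw [hpt, smul_eq_mul, smul_eq_mul] at hh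
  rw [le_div_iff₀ hL] at hη
  have hstep : L * η / 2 * ‖Δ‖ ^ 2 ≤ (1 - τ) * -(⟪G' α, Δ⟫ + h (α + Δ) - h α) := by
    have h1 := mul_le_mul_of_nonneg_right hη (sq_nonneg ‖Δ‖)
    have h2 := mul_le_mul_of_nonneg_left hdecr (sub_nonneg.2 hτ)
    linarith
  have hscaled := mul_le_mul_of_nonneg_left hstep hη0
  linarith

/-- Backtracking termination and step-size lower bound from Lemma 2: the set of
backtracking exponents satisfying the Armijo condition is nonempty, and the step size
returned by backtracking satisfies `β^{i₀} ≥ min(1, β(1-τ)(C1+C2)/L)`. -/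
theorem backtracking_terminates
    {E : Type*} [NormedAddCommGroup E] [InnerProductSpace ℝ E]
    (G h : E → ℝ) (G' : E → E) (L : ℝ) (hL : 0 < L)
    (hGconv : ConvexOn ℝ Set.univ G)
    (hGdiff : ∀ x : E, HasFDerivAt G ((InnerProductSpace.toDualMap ℝ E (G' x) : E →L[ℝ] ℝ)) x)
    (hGlip : ∀ x y : E, ‖G' x - G' y‖ ≤ L * ‖x - y‖)
    (hhconv : ConvexOn ℝ Set.univ h)
    (f : E → ℝ) (hf : ∀ x : E, f x = G x + h x)
    (α : E) (B : E →L[ℝ] E)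
    (hBsa : ∀ x y : E, ⟪B x, y⟫ = ⟪x, B y⟫)
    (C1 C2 : ℝ) (hC2 : 0 < C2) (hC12 : 0 < C1 + C2)
    (hB : ∀ d : E, C1 * ‖d‖ ^ 2 ≤ ⟪d, B d⟫)
    (Q : E → ℝ)
    (hQ : ∀ d : E, Q d = ⟪G' α, d⟫ + 1 / 2 * ⟪d, B d⟫ + h (α + d))
    (hQsc : StrongConvex C2 Q)
    (Δ : E) (hΔ : ∀ d : E, Q Δ ≤ Q d)
    (Δhat : ℝ) (hΔhat : Δhat = ⟪G' α, Δ⟫ + h (α + Δ) - h α)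
    (τ : ℝ) (hτ : τ ∈ Set.Ioo (0 : ℝ) 1) :
    ∀ β : ℝ, β ∈ Set.Ioo (0 : ℝ) 1 →
      ({i : ℕ | f (α + β ^ i • Δ) ≤ f α + β ^ i * τ * Δhat}.Nonempty ∧
        β ^ sInf {i : ℕ | f (α + β ^ i • Δ) ≤ f α + β ^ i * τ * Δhat} ≥
          min 1 (β * (1 - τ) * (C1 + C2) / L)) := by
  rintro β ⟨hβ0, hβ1⟩
  obtain rfl : Q = fun d => ⟪G' α, d⟫ + 1 / 2 * ⟪d, B d⟫ + h (α + d) := funext hQ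
  have hc : 0 < (1 - τ) * (C1 + C2) / L := div_pos (mul_pos (sub_pos.2 hτ.2) hC12) hL
  have harmijo (i : ℕ) (hi : β ^ i ≤ (1 - τ) * (C1 + C2) / L) :
      i ∈ {i : ℕ | f (α + β ^ i • Δ) ≤ f α + β ^ i * τ * Δhat} := by
    rw [Set.mem_ofPred_eq, hf, hf, hΔhat]
    exact armijo_of_le hL hGdiff hGlip hhconv (hB Δ) hQsc hΔ hτ.2.le (pow_nonneg hβ0.le i)
      (pow_le_one₀ hβ0.le hβ1.le) hi
  obtain ⟨n, hn⟩ := exists_pow_lt_of_lt_one hc hβ1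
  refine ⟨⟨n, harmijo n hn.le⟩, ?_⟩
  rcases hi : sInf {i : ℕ | f (α + β ^ i • Δ) ≤ f α + β ^ i * τ * Δhat} with _ | k
  · simp
  · have hk : (1 - τ) * (C1 + C2) / L < β ^ k := by
      by_contra! hle
      have := Nat.sInf_le (harmijo k hle)
      omega
    refine (min_le_right _ _).trans ?_
    rw [pow_succ', mul_assoc, mul_div_assoc]
    exact mul_le_mul_of_nonneg_left hk.le hβ0.le
end

section
/- Let E be a real inner product space, G : E → ℝ convex and differentiable, h : E → ℝ convex, α ∈ E, and B : E → E a continuous linear self-adjoint map. Define Q(d) := ⟪∇G(α), d⟫ + (1/2)·⟪d, B d⟫ + h(α+d). If d = 0 is a global minimizer of Q over E, then α is a global minimizer of f := G + h over E. -/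
open RealInnerProductSpace

/-- The first-order lower bound for a convex function differentiable at a point. -/
theorem ConvexOn.add_fderiv_apply_le {E : Type*} [NormedAddCommGroup E] [NormedSpace ℝ E]
    {f : E → ℝ} {f' : E →L[ℝ] ℝ} {a : E} (hf : ConvexOn ℝ Set.univ f)
    (hf' : HasFDerivAt f f' a) (x : E) : f a + f' (x - a) ≤ f x := by
  have hconv : ConvexOn ℝ Set.univ (f ∘ AffineMap.lineMap (k := ℝ) a x) :=
    hf.comp_affineMap (AffineMap.lineMap a x)
  have hderiv : HasDerivAt (f ∘ AffineMap.lineMap (k := ℝ) a x) (f' (x - a)) 0 := by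
    refine HasFDerivAt.comp_hasDerivAt (0 : ℝ) ?_ AffineMap.hasDerivAt_lineMap
    simpa using hf'
  have hslope := hconv.le_slope_of_hasDerivAt (Set.mem_univ 0) (Set.mem_univ 1) one_pos hderiv
  simp only [slope_def_field, Function.comp_apply, AffineMap.lineMap_apply_one,
    AffineMap.lineMap_apply_zero, sub_zero, div_one] at hslope
  linarith

theorem nonneg_of_forall_nonneg_add_mul {a b : ℝ}
    (hab : ∀ t : ℝ, 0 < t → t ≤ 1 → 0 ≤ a + t * b) : 0 ≤ a := by
  have hlim : Filter.Tendsto (fun t : ℝ => a + t * b) (nhdsWithin 0 (Set.Ioi 0)) (nhds a) := by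
    have hcont : Continuous fun t : ℝ => a + t * b := by fun_prop
    simpa using (hcont.tendsto 0).mono_left nhdsWithin_le_nhds
  refine ge_of_tendsto hlim ?_
  filter_upwards [Ioc_mem_nhdsGT (zero_lt_one (α := ℝ))] with t ht using hab t ht.1 ht.2

open RealInnerProductSpace

/-- Stationarity claim from the proof of Lemma 2: if the zero direction minimizes the
quadratic model, then the current point minimizes `f = G + h`. -/
theorem zero_direction_implies_optimal
    {E : Type*} [NormedAddCommGroup E] [InnerProductSpace ℝ E]
    (G h : E → ℝ) (G' : E → E) (α : E) (B : E →L[ℝ] E)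
    (hGconv : ConvexOn ℝ Set.univ G)
    (hGdiff : ∀ x : E, HasFDerivAt G ((InnerProductSpace.toDualMap ℝ E (G' x) : E →L[ℝ] ℝ)) x)
    (hhconv : ConvexOn ℝ Set.univ h)
    (hBsa : ∀ x y : E, ⟪B x, y⟫ = ⟪x, B y⟫)
    (Q : E → ℝ)
    (hQ : ∀ d : E, Q d = ⟪G' α, d⟫ + 1 / 2 * ⟪d, B d⟫ + h (α + d))
    (hzero : ∀ d : E, Q 0 ≤ Q d) :
    ∀ x : E, G α + h α ≤ G x + h x := by
  intro x
  have hG := hGconv.add_fderiv_apply_le (hGdiff α) x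
  rw [InnerProductSpace.toDualMap_apply_apply] at hG
  have hdir : 0 ≤ ⟪G' α, x - α⟫ + h x - h α := by
    refine nonneg_of_forall_nonneg_add_mul (b := 1 / 2 * ⟪x - α, B (x - α)⟫) fun t ht ht1 => ?_
    have hmin := hzero (t • (x - α))
    simp only [hQ, map_smul, map_zero, inner_zero_right, inner_smul_left, inner_smul_right,
      add_zero, mul_zero, zero_add, conj_trivial] at hmin
    have hconv := hhconv.2 (Set.mem_univ α) (Set.mem_univ x) (sub_nonneg.2 ht1) ht.le
      (sub_add_cancel 1 t)
    have hpoint : (1 - t) • α + t • x = α + t • (x - α) := by module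
    rw [hpoint, smul_eq_mul, smul_eq_mul] at hconv
    refine nonneg_of_mul_nonneg_right ?_ ht
    linarith
  linarith
end

section
/- Under the standing hypotheses (E a real inner product space; G : E → ℝ convex, differentiable, ∇G L-Lipschitz with L > 0; h : E → ℝ convex; f := G + h attains its minimum f* and satisfies the KL inequality with constant μ > 0; constants C1, C2 > 0, C3 > 0 with C1 + C2 > 0, τ, β ∈ (0,1)), consider sequences (αₜ), (Δₜ), (ηₜ), (Bₜ), (sₜ) such that for every t: Bₜ is a continuous linear self-adjoint map with ⟪d, Bₜd⟫ ≥ C1‖d‖² for all d and ‖Bₜ‖ ≤ C3; Qₜ(d) := ⟪∇G(αₜ), d⟫ + (1/2)⟪d, Bₜd⟫ + h(αₜ+d) is C2-strongly convex; Δₜ is a global minimizer of Qₜ; sₜ is a subgradient of h at αₜ + Δₜ with ∇G(αₜ) + BₜΔₜ + sₜ = 0; ηₜ ∈ [η̄, 1] with η̄ := min(1, β(1-τ)(C1+C2)/L) satisfies the Armijo condition f(αₜ+ηₜΔₜ) ≤ f(αₜ) + ηₜτ·(⟪∇G(αₜ),Δₜ⟫ + h(αₜ+Δₜ) - h(αₜ));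 and αₜ₊₁ = αₜ + ηₜΔₜ. Then, with C4 := 2(L² + C3²)/(μ(C1+C2)τ) and r := (1 - η̄ + C4)/(1 + C4), one has r ∈ [0,1) and f(αₜ) - f* ≤ rᵗ·(f(α₀) - f*) for every t, i.e., the dual objective values converge Q-linearly. -/
open RealInnerProductSpace

/-- `s` is a subgradient of `F` at `x`. -/
def IsSubgradient {E : Type*} [NormedAddCommGroup E] [InnerProductSpace ℝ E]
    (F : E → ℝ) (s x : E) : Prop :=
  ∀ y : E, F y ≥ F x + ⟪s, y - x⟫

/-- The gradient of a differentiable convex function is a subgradient. -/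
theorem ConvexOn.isSubgradient_of_hasFDerivAt
    {E : Type*} [NormedAddCommGroup E] [InnerProductSpace ℝ E] {G : E → ℝ} {g x : E}
    (hG : ConvexOn ℝ Set.univ G)
    (hg : HasFDerivAt G (InnerProductSpace.toDualMap ℝ E g : E →L[ℝ] ℝ) x) :
    IsSubgradient G g x := by
  intro y
  have hconv : ConvexOn ℝ Set.univ (G ∘ AffineMap.lineMap (k := ℝ) x y) := by
    simpa using hG.comp_affineMap (AffineMap.lineMap (k := ℝ) x y)
  have hderiv : HasDerivAt (G ∘ AffineMap.lineMap (k := ℝ) x y) ⟪g, y - x⟫ 0 := by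
    have hline : HasDerivAt (AffineMap.lineMap (k := ℝ) x y) (y - x) (0 : ℝ) :=
      AffineMap.hasDerivAt_lineMap
    have hg' : HasFDerivAt G (InnerProductSpace.toDualMap ℝ E g : E →L[ℝ] ℝ)
        (AffineMap.lineMap (k := ℝ) x y 0) := by simpa using hg
    simpa using hg'.comp_hasDerivAt (0 : ℝ) hline
  have hslope := hconv.le_slope_of_hasDerivAt (Set.mem_univ 0) (Set.mem_univ 1)
    zero_lt_one hderiv
  simp [slope_def_field] at hslope
  linarith

theorem IsSubgradient.add {E : Type*} [NormedAddCommGroup E] [InnerProductSpace ℝ E]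
    {F H : E → ℝ} {s t x : E} (hF : IsSubgradient F s x) (hH : IsSubgradient H t x) :
    IsSubgradient (fun y => F y + H y) (s + t) x := by
  intro y
  have h₁ := hF y
  have h₂ := hH y
  simp only [inner_add_left]
  linarith

/-- A strongly convex function grows quadratically away from a global minimizer. -/
theorem StrongConvex.add_le_of_isMin {E : Type*} [NormedAddCommGroup E] [InnerProductSpace ℝ E]
    {C : ℝ} {F : E → ℝ} {x : E} (hF : StrongConvex C F) (hx : ∀ y, F x ≤ F y)
    (y : E) : F x + C / 2 * ‖y - x‖ ^ 2 ≤ F y := by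
  by_contra! hlt
  set c := C / 2 * ‖y - x‖ ^ 2 with hc
  have hxy := hx y
  have hcpos : 0 < c := by linarith
  set l := (c - (F y - F x)) / (2 * c) with hl
  have hl0 : 0 < l := div_pos (by linarith) (by linarith)
  have hl1 : l ≤ 1 := by rw [hl, div_le_one (by linarith)]; linarith
  have hlc : l * (2 * c) = c - (F y - F x) := div_mul_cancel₀ _ (by positivity)
  have h₁ := hF y x l ⟨hl0.le, hl1⟩
  have h₂ := hx (l • y + (1 - l) • x)
  have h₃ : 0 ≤ l * ((F y - F x) - c * (1 - l)) := by
    rw [hc]; nlinarith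
  have h₄ := nonneg_of_mul_nonneg_right h₃ hl0
  nlinarith

/-- Theorem 1 of the paper: global Q-linear convergence of the exact block-diagonal
approximation method with backtracking line search. -/
theorem global_linear_convergence_exact
    {E : Type*} [NormedAddCommGroup E] [InnerProductSpace ℝ E]
    (G h f : E → ℝ) (G' : E → E) (L μ C1 C2 C3 τ β : ℝ)
    (hL : 0 < L) (hμ : 0 < μ) (hC1 : 0 < C1) (hC2 : 0 < C2) (hC3 : 0 < C3)
    (hC12 : 0 < C1 + C2) (hτ : τ ∈ Set.Ioo (0 : ℝ) 1) (hβ : β ∈ Set.Ioo (0 : ℝ) 1)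
    (hGconv : ConvexOn ℝ Set.univ G)
    (hGdiff : ∀ x : E, HasFDerivAt G ((InnerProductSpace.toDualMap ℝ E (G' x) : E →L[ℝ] ℝ)) x)
    (hGlip : ∀ x y : E, ‖G' x - G' y‖ ≤ L * ‖x - y‖)
    (hhconv : ConvexOn ℝ Set.univ h)
    (hf : ∀ x : E, f x = G x + h x)
    (fstar : ℝ) (hfmin : ∀ x : E, fstar ≤ f x) (hfattain : ∃ x : E, f x = fstar)
    (hKL : ∀ (x s : E), IsSubgradient f s x → f x - fstar ≤ ‖s‖ ^ 2 / (2 * μ))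
    (αs Δs : ℕ → E) (ηs : ℕ → ℝ) (Bs : ℕ → E →L[ℝ] E) (ss : ℕ → E)
    (hBsa : ∀ (t : ℕ) (x y : E), ⟪Bs t x, y⟫ = ⟪x, Bs t y⟫)
    (hB : ∀ (t : ℕ) (d : E), C1 * ‖d‖ ^ 2 ≤ ⟪d, Bs t d⟫)
    (hBnorm : ∀ t : ℕ, ‖Bs t‖ ≤ C3)
    (hQsc : ∀ t : ℕ, StrongConvex C2
      (fun d : E => ⟪G' (αs t), d⟫ + 1 / 2 * ⟪d, Bs t d⟫ + h (αs t + d)))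
    (hΔmin : ∀ (t : ℕ) (d : E),
      ⟪G' (αs t), Δs t⟫ + 1 / 2 * ⟪Δs t, Bs t (Δs t)⟫ + h (αs t + Δs t) ≤
        ⟪G' (αs t), d⟫ + 1 / 2 * ⟪d, Bs t d⟫ + h (αs t + d))
    (hsub : ∀ t : ℕ, IsSubgradient h (ss t) (αs t + Δs t))
    (hstat : ∀ t : ℕ, G' (αs t) + Bs t (Δs t) + ss t = 0)
    (ηbar : ℝ) (hηbar : ηbar = min 1 (β * (1 - τ) * (C1 + C2) / L))
    (hη : ∀ t : ℕ, ηs t ∈ Set.Icc ηbar 1)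
    (harmijo : ∀ t : ℕ, f (αs t + ηs t • Δs t) ≤
      f (αs t) + ηs t * τ * (⟪G' (αs t), Δs t⟫ + h (αs t + Δs t) - h (αs t)))
    (hrec : ∀ t : ℕ, αs (t + 1) = αs t + ηs t • Δs t)
    (C4 r : ℝ) (hC4 : C4 = 2 * (L ^ 2 + C3 ^ 2) / (μ * (C1 + C2) * τ))
    (hr : r = (1 - ηbar + C4) / (1 + C4)) :
    0 ≤ r ∧ r < 1 ∧ ∀ t : ℕ, f (αs t) - fstar ≤ r ^ t * (f (αs 0) - fstar) := by
  have hτ0 : 0 < τ := hτ.1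
  have hη0 : 0 < ηbar := by
    rw [hηbar]
    have hβ0 := hβ.1
    have hτ1 : 0 < 1 - τ := sub_pos.2 hτ.2
    exact lt_min one_pos (by positivity)
  have hη1 : ηbar ≤ 1 := hηbar ▸ min_le_left _ _
  have hC40 : 0 < C4 := by rw [hC4]; positivity
  have hr0 : 0 ≤ r := by rw [hr]; exact div_nonneg (by linarith) (by linarith)
  refine ⟨hr0, by rw [hr, div_lt_one (by linarith)]; linarith, ?_⟩
  have hfconv : ConvexOn ℝ Set.univ f := by
    have : f = G + h := funext hf
    exact this ▸ hGconv.add hhconv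
  have hstep : ∀ t, f (αs (t + 1)) - fstar ≤ r * (f (αs t) - fstar) := by
    intro t
    set D := ⟪G' (αs t), Δs t⟫ + h (αs t + Δs t) - h (αs t) with hD
    have hdecr : (C1 + C2) / 2 * ‖Δs t‖ ^ 2 ≤ -D := by
      have h₁ := (hQsc t).add_le_of_isMin (hΔmin t) 0
      have h₂ := hB t (Δs t)
      simp only [inner_zero_right, zero_sub, norm_neg, add_zero, mul_zero,
        zero_add, map_zero] at h₁
      linarith
    have hgap : f (αs t + Δs t) - fstar ≤ C4 * τ * -D := by
      have hs : IsSubgradient f (G' (αs t + Δs t) + ss t) (αs t + Δs t) := by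
        have := (hGconv.isSubgradient_of_hasFDerivAt (hGdiff (αs t + Δs t))).add (hsub t)
        rwa [← funext hf] at this
      have h₁ := hKL _ _ hs
      have hss : G' (αs t + Δs t) + ss t = (G' (αs t + Δs t) - G' (αs t)) - Bs t (Δs t) := by
        rw [eq_neg_of_add_eq_zero_right (hstat t)]; abel
      have h₂ : ‖G' (αs t + Δs t) + ss t‖ ≤ L * ‖Δs t‖ + C3 * ‖Δs t‖ := by
        rw [hss]
        refine (norm_sub_le _ _).trans (add_le_add ?_ ?_)
        · simpa using hGlip (αs t + Δs t) (αs t)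
        · exact (Bs t).le_of_opNorm_le (hBnorm t) _
      have h₃ : ‖G' (αs t + Δs t) + ss t‖ ^ 2 ≤ 2 * (L ^ 2 + C3 ^ 2) * ‖Δs t‖ ^ 2 := by
        refine (pow_le_pow_left₀ (norm_nonneg _) h₂ 2).trans ?_
        nlinarith [sq_nonneg (L * ‖Δs t‖ - C3 * ‖Δs t‖)]
      calc f (αs t + Δs t) - fstar ≤ ‖G' (αs t + Δs t) + ss t‖ ^ 2 / (2 * μ) := h₁
        _ ≤ 2 * (L ^ 2 + C3 ^ 2) * ‖Δs t‖ ^ 2 / (2 * μ) := by gcongr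
        _ = C4 * τ * ((C1 + C2) / 2 * ‖Δs t‖ ^ 2) := by rw [hC4]; field_simp
        _ ≤ C4 * τ * -D := by gcongr
    obtain ⟨hηl, hηu⟩ := hη t
    have hηt : 0 < ηs t := hη0.trans_le hηl
    have hcomb : f (αs (t + 1)) ≤ (1 - ηs t) * f (αs t) + ηs t * f (αs t + Δs t) := by
      have h₁ := hfconv.2 (Set.mem_univ (αs t)) (Set.mem_univ (αs t + Δs t))
        (sub_nonneg.2 hηu) hηt.le (by ring)
      have h₂ : (1 - ηs t) • αs t + ηs t • (αs t + Δs t) = αs (t + 1) := by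
        rw [hrec]; module
      simpa only [h₂, smul_eq_mul] using h₁
    have harm : f (αs (t + 1)) ≤ f (αs t) + ηs t * τ * D := by
      rw [hrec]; exact harmijo t
    have h₁ := mul_le_mul_of_nonneg_left harm hC40.le
    have h₂ := mul_le_mul_of_nonneg_left hgap hηt.le
    have h₃ := mul_le_mul_of_nonneg_right hηl (sub_nonneg.2 (hfmin (αs t)))
    rw [hr, div_mul_eq_mul_div, le_div_iff₀ (by linarith)]
    linarith
  intro t
  induction t with
  | zero => simp
  | succ t ih =>
    calc f (αs (t + 1)) - fstar ≤ r * (f (αs t) - fstar) := hstep t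
      _ ≤ r * (r ^ t * (f (αs 0) - fstar)) := by gcongr
      _ = r ^ (t + 1) * (f (αs 0) - fstar) := by ring
end

section
/- Let E be a real inner product space, G : E → ℝ convex and differentiable, h : E → ℝ convex, α ∈ E, and B : E → E a continuous linear self-adjoint map with ⟪d, Bd⟫ ≥ C1·‖d‖² for all d (C1 ∈ ℝ). Define Q(d) := ⟪∇G(α), d⟫ + (1/2)⟪d, Bd⟫ + h(α+d), assume Q is C2-strongly convex with C2 > 0 and attains its infimum Q*. Let γ ∈ [0,1) and let Δ ∈ E satisfy Q(Δ) - Q* ≤ γ·(Q(0) - Q*) (Δ solves the model at least γ-approximately). Then the predicted decrease Δ̂ := ⟪∇G(α), Δ⟫ + h(α+Δ) - h(α) satisfies Δ̂ ≤ -(1/2)·( ((1-√γ)/(1+√γ))·C2 + C1 )·‖Δ‖². -/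
open RealInnerProductSpace

/-- If the chord between the values `a` and `b` dominates `K * (l * (1 - l))` on `[0, 1]` and
`b ≤ s ^ 2 * a`, then the gap `a - b` is at least `(1 - s) / (1 + s) * K`. -/
lemma gap_of_chord_lower_bound {a b K s : ℝ} (hs0 : 0 ≤ s) (hs1 : s < 1) (hb0 : 0 ≤ b)
    (hb : b ≤ s ^ 2 * a)
    (hchord : ∀ l ∈ Set.Icc (0 : ℝ) 1, K * (l * (1 - l)) ≤ l * b + (1 - l) * a) :
    (1 - s) / (1 + s) * K ≤ a - b := by
  have hs : 0 < 1 + s := by linarith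
  rcases hs0.eq_or_lt with rfl | hspos
  · obtain rfl : b = 0 := by linarith
    suffices K ≤ a by simpa
    by_contra! hK
    have ha : 0 ≤ a := by simpa using hchord 0 (by simp)
    have hKpos : 0 < K := by linarith
    have hl : K * ((a + K) / (2 * K)) = (a + K) / 2 := by field_simp
    have hl1 : (a + K) / (2 * K) < 1 := by rw [div_lt_one (by linarith)]; linarith
    have h := hchord ((a + K) / (2 * K)) ⟨by positivity, hl1.le⟩
    rw [← mul_assoc, hl] at h
    nlinarith
  · have h := hchord (1 / (1 + s)) ⟨by positivity, by rw [div_le_one hs]; linarith⟩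
    have hl : 1 - 1 / (1 + s) = s / (1 + s) := by field_simp; ring
    rw [hl] at h
    have hK : K * s ≤ (1 + s) * (b + s * a) := by
      field_simp at h
      linarith
    rw [div_mul_eq_mul_div, div_le_iff₀ hs]
    refine le_of_mul_le_mul_left ?_ hspos
    have h1 := mul_le_mul_of_nonneg_left hK (sub_nonneg.2 hs1.le)
    have h2 := mul_le_mul_of_nonneg_left hb hs.le
    linarith

/-- Inexact descent inequality underlying Lemma 3: a `γ`-approximate minimizer of the
quadratic model is still a descent direction. -/
theorem inexact_model_descent
    {E : Type*} [NormedAddCommGroup E] [InnerProductSpace ℝ E]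
    (G h : E → ℝ) (G' : E → E) (α : E) (B : E →L[ℝ] E)
    (hGconv : ConvexOn ℝ Set.univ G)
    (hGdiff : ∀ x : E, HasFDerivAt G ((InnerProductSpace.toDualMap ℝ E (G' x) : E →L[ℝ] ℝ)) x)
    (hhconv : ConvexOn ℝ Set.univ h)
    (hBsa : ∀ x y : E, ⟪B x, y⟫ = ⟪x, B y⟫)
    (C1 C2 : ℝ) (hC2 : 0 < C2)
    (hB : ∀ d : E, C1 * ‖d‖ ^ 2 ≤ ⟪d, B d⟫)
    (Q : E → ℝ)
    (hQ : ∀ d : E, Q d = ⟪G' α, d⟫ + 1 / 2 * ⟪d, B d⟫ + h (α + d))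
    (hQsc : StrongConvex C2 Q)
    (Qstar : ℝ) (hQmin : ∀ d : E, Qstar ≤ Q d) (hQattain : ∃ d : E, Q d = Qstar)
    (γ : ℝ) (hγ : γ ∈ Set.Ico (0 : ℝ) 1)
    (Δ : E) (happrox : Q Δ - Qstar ≤ γ * (Q 0 - Qstar)) :
    ⟪G' α, Δ⟫ + h (α + Δ) - h α ≤
      -(1 / 2) * ((1 - Real.sqrt γ) / (1 + Real.sqrt γ) * C2 + C1) * ‖Δ‖ ^ 2 := by
  have hchord : ∀ l ∈ Set.Icc (0 : ℝ) 1, C2 / 2 * ‖Δ‖ ^ 2 * (l * (1 - l)) ≤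
      l * (Q Δ - Qstar) + (1 - l) * (Q 0 - Qstar) := by
    intro l hl
    have h1 := hQsc Δ 0 l hl
    have h2 := hQmin (l • Δ + (1 - l) • 0)
    rw [sub_zero] at h1
    linarith
  have hgap := gap_of_chord_lower_bound (Real.sqrt_nonneg γ)
    (by rw [Real.sqrt_lt' one_pos]; simpa using hγ.2) (sub_nonneg.2 (hQmin Δ))
    (by rwa [Real.sq_sqrt hγ.1]) hchord
  have hQ0 : Q 0 = h α := by simp [hQ]
  rw [hQ0, hQ Δ] at hgap
  linarith [hB Δ]
end

section
/- Let E be a real inner product space, G : E → ℝ convex and differentiable with ∇G Lipschitz with constant L > 0, h : E → ℝ convex, f := G + h, α ∈ E, B : E → E continuous linear self-adjoint with ⟪d, Bd⟫ ≥ C1·‖d‖² for all d, Q(d) := ⟪∇G(α), d⟫ + (1/2)⟪d, Bd⟫ + h(α+d) C2-strongly convex with C2 > 0, (1-√γ)C2 + (1+√γ)C1 > 0, and let Δ solve the model at least γ-approximately for some γ ∈ [0,1) (Q attains its infimum Q* and Q(Δ) - Q* ≤ γ(Q(0) - Q*)). Then for every τ ∈ (0,1) and every η ∈ [0,1] with η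 ≤ (1-τ)·((1-√γ)C2 + (1+√γ)C1)/((1+√γ)·L), the Armijo condition f(α+ηΔ) ≤ f(α) + η·τ·Δ̂ holds (Δ̂ := ⟪∇G(α), Δ⟫ + h(α+Δ) - h(α)); consequently, for β ∈ (0,1) the backtracking line search terminates and returns a step size η ≥ min(1, β(1-τ)·((1-√γ)C2 + (1+√γ)C1)/((1+√γ)·L)). -/
open RealInnerProductSpace

/-- The descent lemma: a function with `L`-Lipschitz gradient lies below its quadratic model. -/
theorem le_quadratic_model_of_lipschitz_gradient
    {E : Type*} [NormedAddCommGroup E] [InnerProductSpace ℝ E]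
    {G : E → ℝ} {G' : E → E} {L : ℝ}
    (hGdiff : ∀ x : E, HasFDerivAt G ((InnerProductSpace.toDualMap ℝ E (G' x) : E →L[ℝ] ℝ)) x)
    (hGlip : ∀ x y : E, ‖G' x - G' y‖ ≤ L * ‖x - y‖) (x d : E) {t : ℝ} (ht : 0 ≤ t) :
    G (x + t • d) ≤ G x + t * ⟪G' x, d⟫ + L / 2 * t ^ 2 * ‖d‖ ^ 2 := by
  have hderiv : ∀ u : ℝ, HasDerivAt
      (fun u : ℝ => G (x + u • d) - u * ⟪G' x, d⟫ - L / 2 * u ^ 2 * ‖d‖ ^ 2)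
      (⟪G' (x + u • d), d⟫ - ⟪G' x, d⟫ - L * u * ‖d‖ ^ 2) u := by
    intro u
    have hline : HasDerivAt (fun u : ℝ => x + u • d) d u := by
      simpa using ((hasDerivAt_id u).smul_const d).const_add x
    have hG : HasDerivAt (fun u : ℝ => G (x + u • d)) ⟪G' (x + u • d), d⟫ u := by
      exact ((hGdiff (x + u • d)).comp_hasDerivAt u hline).congr_deriv
        (InnerProductSpace.toDualMap_apply_apply ..)
    have hlin := (hasDerivAt_id u).mul_const ⟪G' x, d⟫
    have hquad := (((hasDerivAt_id u).pow 2).const_mul (L / 2)).mul_const (‖d‖ ^ 2)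
    refine ((hG.sub hlin).sub hquad).congr_deriv ?_
    simp only [id, Nat.cast_ofNat, Nat.add_one_sub_one, pow_one]
    ring
  have hanti : AntitoneOn
      (fun u : ℝ => G (x + u • d) - u * ⟪G' x, d⟫ - L / 2 * u ^ 2 * ‖d‖ ^ 2) (Set.Ici 0) := by
    refine antitoneOn_of_deriv_nonpos (convex_Ici 0)
      (fun u _ => (hderiv u).continuousAt.continuousWithinAt)
      (fun u _ => (hderiv u).differentiableAt.differentiableWithinAt) ?_
    intro u hu
    rw [interior_Ici, Set.mem_Ioi] at hu
    rw [(hderiv u).deriv, ← inner_sub_left]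
    have hcs := real_inner_le_norm (G' (x + u • d) - G' x) d
    have hlip := hGlip (x + u • d) x
    rw [add_sub_cancel_left, norm_smul, Real.norm_of_nonneg hu.le] at hlip
    nlinarith [mul_le_mul_of_nonneg_right hlip (norm_nonneg d)]
  have h := hanti (Set.mem_Ici.2 le_rfl) (Set.mem_Ici.2 ht) ht
  simp only [zero_smul, add_zero] at h
  linarith

/-- Quadratic decrease of a strongly convex function at an approximate minimizer, where `s ^ 2` is
the relative accuracy. -/
theorem StrongConvex.sub_le_of_approx_min
    {E : Type*} [NormedAddCommGroup E] [InnerProductSpace ℝ E]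
    {C s m : ℝ} {F : E → ℝ} (hF : StrongConvex C F) (hs0 : 0 ≤ s) (hs1 : s < 1)
    (hm : ∀ z, m ≤ F z) {x y : E} (hx : F x - m ≤ s ^ 2 * (F y - m)) :
    (1 + s) * (F x - F y) ≤ -((1 - s) * C / 2 * ‖x - y‖ ^ 2) := by
  have key : ∀ l : ℝ, 0 ≤ l → l ≤ 1 →
      C / 2 * ‖x - y‖ ^ 2 * (l * (1 - l)) ≤ (l * s ^ 2 + (1 - l)) * (F y - m) := by
    intro l h0 h1
    have h := (hm _).trans (hF x y l ⟨h0, h1⟩)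
    nlinarith [mul_le_mul_of_nonneg_left hx h0]
  have hb : C / 2 * ‖x - y‖ ^ 2 ≤ (1 + s) ^ 2 * (F y - m) := by
    rcases hs0.eq_or_lt with rfl | hs
    · have hy : 0 ≤ F y - m := sub_nonneg.2 (hm y)
      by_contra! hlt
      set c := C / 2 * ‖x - y‖ ^ 2
      set b := F y - m
      have hbc : b < c := by simpa using hlt
      have hc : 0 < c := hy.trans_lt hbc
      have hl1 : (b + c) / (2 * c) < 1 := by
        rw [div_lt_one (by positivity)]
        linarith
      have h := key ((b + c) / (2 * c)) (by positivity) hl1.le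
      have hcl : c * ((b + c) / (2 * c)) = (b + c) / 2 := by field_simp
      have hle : c * ((b + c) / (2 * c)) ≤ b :=
        le_of_mul_le_mul_right (by linarith) (sub_pos.2 hl1)
      linarith
    · have h1s : 0 < 1 + s := by linarith
      have h := key (1 / (1 + s)) (by positivity) (by rw [div_le_one h1s]; linarith)
      have hl : 1 / (1 + s) * (1 - 1 / (1 + s)) = s / (1 + s) ^ 2 := by field_simp; ring
      have hr : 1 / (1 + s) * s ^ 2 + (1 - 1 / (1 + s)) = s := by field_simp; ring
      rw [hl, hr, ← mul_div_assoc, div_le_iff₀ (by positivity)] at h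
      exact le_of_mul_le_mul_right (by linarith) hs
  nlinarith [mul_le_mul_of_nonneg_left hb (sub_nonneg.2 hs1.le),
    mul_le_mul_of_nonneg_left hx (show 0 ≤ 1 + s by linarith)]

/-- If every step in `[0, 1]` up to a positive threshold `c` is acceptable, then backtracking from
the unit step terminates with a step of size at least `min 1 (β * c)`. -/
theorem backtracking_terminates_s11 {P : ℝ → Prop} {c β : ℝ} (hc : 0 < c)
    (hP : ∀ t ∈ Set.Icc (0 : ℝ) 1, t ≤ c → P t) (hβ : β ∈ Set.Ioo (0 : ℝ) 1) :
    {i : ℕ | P (β ^ i)}.Nonempty ∧ min 1 (β * c) ≤ β ^ sInf {i : ℕ | P (β ^ i)} := by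
  have hmem : ∀ i : ℕ, β ^ i ∈ Set.Icc (0 : ℝ) 1 := fun i =>
    ⟨pow_nonneg hβ.1.le i, pow_le_one₀ hβ.1.le hβ.2.le⟩
  obtain ⟨n, hn⟩ := exists_pow_lt_of_lt_one hc hβ.2
  refine ⟨⟨n, hP _ (hmem n) hn.le⟩, ?_⟩
  rcases hk : sInf {i : ℕ | P (β ^ i)} with _ | k
  · simp
  · have hnot : ¬ P (β ^ k) :=
      Nat.notMem_of_lt_sInf (s := {i : ℕ | P (β ^ i)}) (hk ▸ k.lt_succ_self)
    have hlt : c < β ^ k := by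
      by_contra! hle
      exact hnot (hP _ (hmem k) hle)
    rw [pow_succ']
    exact (min_le_right _ _).trans (mul_le_mul_of_nonneg_left hlt.le hβ.1.le)

/-- Step-size part of Lemma 3 (inexact version): the Armijo condition holds for all small
enough steps, and backtracking terminates with a step size bounded below by
`min(1, β(1-τ)((1-√γ)C2 + (1+√γ)C1)/((1+√γ)L))`. -/
theorem inexact_armijo_and_backtracking
    {E : Type*} [NormedAddCommGroup E] [InnerProductSpace ℝ E]
    (G h : E → ℝ) (G' : E → E) (L : ℝ) (hL : 0 < L)
    (hGconv : ConvexOn ℝ Set.univ G)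
    (hGdiff : ∀ x : E, HasFDerivAt G ((InnerProductSpace.toDualMap ℝ E (G' x) : E →L[ℝ] ℝ)) x)
    (hGlip : ∀ x y : E, ‖G' x - G' y‖ ≤ L * ‖x - y‖)
    (hhconv : ConvexOn ℝ Set.univ h)
    (f : E → ℝ) (hf : ∀ x : E, f x = G x + h x)
    (α : E) (B : E →L[ℝ] E)
    (hBsa : ∀ x y : E, ⟪B x, y⟫ = ⟪x, B y⟫)
    (C1 C2 γ : ℝ) (hC2 : 0 < C2) (hγ : γ ∈ Set.Ico (0 : ℝ) 1)
    (hpos : 0 < (1 - Real.sqrt γ) * C2 + (1 + Real.sqrt γ) * C1)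
    (hB : ∀ d : E, C1 * ‖d‖ ^ 2 ≤ ⟪d, B d⟫)
    (Q : E → ℝ)
    (hQ : ∀ d : E, Q d = ⟪G' α, d⟫ + 1 / 2 * ⟪d, B d⟫ + h (α + d))
    (hQsc : StrongConvex C2 Q)
    (Qstar : ℝ) (hQmin : ∀ d : E, Qstar ≤ Q d) (hQattain : ∃ d : E, Q d = Qstar)
    (Δ : E) (happrox : Q Δ - Qstar ≤ γ * (Q 0 - Qstar))
    (Δhat : ℝ) (hΔhat : Δhat = ⟪G' α, Δ⟫ + h (α + Δ) - h α) :
    ∀ τ : ℝ, τ ∈ Set.Ioo (0 : ℝ) 1 →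
      (∀ η : ℝ, η ∈ Set.Icc (0 : ℝ) 1 →
        η ≤ (1 - τ) * ((1 - Real.sqrt γ) * C2 + (1 + Real.sqrt γ) * C1) /
              ((1 + Real.sqrt γ) * L) →
        f (α + η • Δ) ≤ f α + η * τ * Δhat) ∧
      (∀ β : ℝ, β ∈ Set.Ioo (0 : ℝ) 1 →
        ({i : ℕ | f (α + β ^ i • Δ) ≤ f α + β ^ i * τ * Δhat}.Nonempty ∧
          β ^ sInf {i : ℕ | f (α + β ^ i • Δ) ≤ f α + β ^ i * τ * Δhat} ≥
            min 1 (β * (1 - τ) * ((1 - Real.sqrt γ) * C2 + (1 + Real.sqrt γ) * C1) /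
              ((1 + Real.sqrt γ) * L)))) := by
  intro τ hτ
  set s := Real.sqrt γ with hs
  set K := (1 - s) * C2 + (1 + s) * C1 with hK
  have hs0 : 0 ≤ s := Real.sqrt_nonneg γ
  have hs1 : s < 1 := by
    rw [hs, Real.sqrt_lt' one_pos]
    simpa using hγ.2
  have hsq : s ^ 2 = γ := Real.sq_sqrt hγ.1
  have hden : 0 < (1 + s) * L := by positivity
  have hdecr : (1 + s) * Δhat ≤ -(K / 2 * ‖Δ‖ ^ 2) := by
    have hQ0 : Q 0 = h α := by simp [hQ]
    have h := hQsc.sub_le_of_approx_min hs0 hs1 hQmin (x := Δ) (y := 0) (by rwa [hsq])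
    rw [sub_zero, hQ0, hQ Δ] at h
    rw [hΔhat, hK]
    nlinarith [mul_le_mul_of_nonneg_left (hB Δ) (show 0 ≤ 1 + s by linarith)]
  have armijo : ∀ η : ℝ, η ∈ Set.Icc (0 : ℝ) 1 → η ≤ (1 - τ) * K / ((1 + s) * L) →
      f (α + η • Δ) ≤ f α + η * τ * Δhat := by
    intro η hη hle
    rw [le_div_iff₀ hden] at hle
    have hG := le_quadratic_model_of_lipschitz_gradient hGdiff hGlip α Δ hη.1
    have hh : h (α + η • Δ) ≤ (1 - η) * h α + η * h (α + Δ) := by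
      have hcomb : (1 - η) • α + η • (α + Δ) = α + η • Δ := by module
      simpa only [hcomb, smul_eq_mul] using hhconv.2 (Set.mem_univ α) (Set.mem_univ (α + Δ))
        (sub_nonneg.2 hη.2) hη.1 (sub_add_cancel 1 η)
    have hstep : L / 2 * η * ‖Δ‖ ^ 2 ≤ -((1 - τ) * Δhat) := by
      refine le_of_mul_le_mul_left ?_ (show 0 < 1 + s by linarith)
      nlinarith [mul_le_mul_of_nonneg_right hle (sq_nonneg ‖Δ‖),
        mul_le_mul_of_nonneg_left hdecr (sub_nonneg.2 hτ.2.le)]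
    have hstep' := mul_le_mul_of_nonneg_left hstep hη.1
    have hsplit : η * Δhat = η * ⟪G' α, Δ⟫ + η * h (α + Δ) - η * h α := by rw [hΔhat]; ring
    rw [hf, hf]
    linarith
  refine ⟨armijo, fun β hβ => ?_⟩
  have hc : 0 < (1 - τ) * K / ((1 + s) * L) := div_pos (mul_pos (sub_pos.2 hτ.2) hpos) hden
  have hβc : β * (1 - τ) * K / ((1 + s) * L) = β * ((1 - τ) * K / ((1 + s) * L)) := by ring
  rw [hβc]
  exact backtracking_terminates_s11 (P := fun t => f (α + t • Δ) ≤ f α + t * τ * Δhat) hc armijo hβ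
end

section
/- Let ε ≥ 0, P ≥ 0, R > 0, σ > 0 be real numbers such that ε ≥ s·P - s²·R²/(2σ) for every s ∈ [0,1]. Then P ≤ √(2εR²/σ) or P ≤ 2ε. -/
/-- Scalar core of the Lipschitz-loss case of Theorem 3: if
`ε ≥ s·P - s²·R²/(2σ)` for all `s ∈ [0,1]`, then `P ≤ √(2εR²/σ)` or `P ≤ 2ε`. -/
theorem primal_dual_scalar_bound
    (ε P R σ : ℝ) (hε : 0 ≤ ε) (hP : 0 ≤ P) (hR : 0 < R) (hσ : 0 < σ)
    (h : ∀ s : ℝ, s ∈ Set.Icc (0 : ℝ) 1 → s * P - s ^ 2 * R ^ 2 / (2 * σ) ≤ ε) :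
    P ≤ Real.sqrt (2 * ε * R ^ 2 / σ) ∨ P ≤ 2 * ε := by
  rcases le_or_gt (P * σ) (R ^ 2) with hle | hlt
  · left
    apply Real.le_sqrt_of_sq_le
    have hs := h (P * σ / R ^ 2) ⟨by positivity, (div_le_one (by positivity)).2 hle⟩
    have hval : P * σ / R ^ 2 * P - (P * σ / R ^ 2) ^ 2 * R ^ 2 / (2 * σ)
        = P ^ 2 * σ / (2 * R ^ 2) := by
      field_simp
      ring
    rw [hval, div_le_iff₀ (by positivity)] at hs
    rw [le_div_iff₀ hσ]
    linarith
  · right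
    have hs := h 1 ⟨zero_le_one, le_rfl⟩
    have hhalf : R ^ 2 / (2 * σ) < P / 2 := by
      rw [div_lt_iff₀ (by positivity)]
      linarith
    rw [one_pow, one_mul, one_mul] at hs
    linarith
end

section
/- Let E be a real inner product space, let f : E → ℝ be a function attaining its minimum value f*, let μ > 0, and let P : E → E be a map such that f(P(α)) = f* for all α ∈ E and such that the optimal-set strong convexity condition holds: f(λα + (1-λ)P(α)) ≤ λ·f(α) + (1-λ)·f* - (μ/2)·λ(1-λ)·‖α - P(α)‖² for all α ∈ E and λ ∈ [0,1]. Then for every α ∈ E and every subgradient s of f at α, f(α) - f* ≤ ‖s‖²/(2μ). -/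
open RealInnerProductSpace

/-- A subgradient at `x` of a function that is strongly convex with modulus `μ` along the segment
from `p` to `x` satisfies the strengthened subgradient inequality between these endpoints. -/
theorem IsSubgradient.sub_le_inner_sub_of_strongConvex_segment
    {E : Type*} [NormedAddCommGroup E] [InnerProductSpace ℝ E]
    {f : E → ℝ} {s x p : E} {μ : ℝ} (hs : IsSubgradient f s x)
    (hf : ∀ l ∈ Set.Icc (0 : ℝ) 1, f (l • x + (1 - l) • p) ≤
      l * f x + (1 - l) * f p - μ / 2 * (l * (1 - l)) * ‖x - p‖ ^ 2) :
    f x - f p ≤ ⟪s, x - p⟫ - μ / 2 * ‖x - p‖ ^ 2 := by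
  have key : ∀ l : ℝ, 0 ≤ l → l < 1 →
      l * (μ / 2 * ‖x - p‖ ^ 2) ≤ ⟪s, x - p⟫ - (f x - f p) := by
    intro l hl0 hl1
    have h := hs (l • x + (1 - l) • p)
    have hy : l • x + (1 - l) • p - x = -(1 - l) • (x - p) := by module
    rw [hy, inner_smul_right] at h
    refine le_of_mul_le_mul_left ?_ (sub_pos.2 hl1)
    linarith [hf l ⟨hl0, hl1.le⟩]
  have hle : μ / 2 * ‖x - p‖ ^ 2 ≤ ⟪s, x - p⟫ - (f x - f p) := by
    have hlim : Filter.Tendsto (fun l : ℝ => l * (μ / 2 * ‖x - p‖ ^ 2)) (nhdsWithin 1 (Set.Iio 1))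
        (nhds (1 * (μ / 2 * ‖x - p‖ ^ 2))) :=
      ((continuous_id.mul continuous_const).tendsto 1).mono_left nhdsWithin_le_nhds
    rw [one_mul] at hlim
    refine le_of_tendsto hlim ?_
    filter_upwards [Ioo_mem_nhdsLT (zero_lt_one' ℝ)] with l hl using key l hl.1.le hl.2
  linarith

/-- Optimal-set strong convexity (Assumption 4 of the paper, with `P` the projection onto
the optimal set) implies the Kurdyka–Łojasiewicz inequality with exponent `1/2`
(Assumption 3). -/
theorem kl_of_optimal_set_strong_convexity
    {E : Type*} [NormedAddCommGroup E] [InnerProductSpace ℝ E]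
    (f : E → ℝ) (fstar : ℝ)
    (hfmin : ∀ x : E, fstar ≤ f x) (hfattain : ∃ x : E, f x = fstar)
    (μ : ℝ) (hμ : 0 < μ)
    (P : E → E) (hP : ∀ α : E, f (P α) = fstar)
    (hossc : ∀ α : E, ∀ l : ℝ, l ∈ Set.Icc (0 : ℝ) 1 →
      f (l • α + (1 - l) • P α) ≤
        l * f α + (1 - l) * fstar - μ / 2 * (l * (1 - l)) * ‖α - P α‖ ^ 2) :
    ∀ α s : E, IsSubgradient f s α → f α - fstar ≤ ‖s‖ ^ 2 / (2 * μ) := by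
  intro α s hs
  have h := hs.sub_le_inner_sub_of_strongConvex_segment (p := P α)
    fun l hl => by simpa only [hP] using hossc α l hl
  rw [hP] at h
  have hcs := real_inner_le_norm s (α - P α)
  rw [le_div_iff₀ (by positivity)]
  nlinarith [sq_nonneg (‖s‖ - μ * ‖α - P α‖)]
end

section
/- Let y ∈ ℝ with y = 1 or y = -1, let C > 0, and let α ∈ ℝ. If 0 ≤ α·y ≤ C, then the function z ↦ -α·z - C·max(1 - y·z, 0) on ℝ is bounded above and its supremum equals -α·y. If instead α·y < 0 or α·y > C, this function is unbounded above. -/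
/-- For a label `y` with `y² = 1`, the expression in the hinge conjugate depends only on the
margin `yz` and on `αy`. -/
theorem hinge_conjugate_objective_at_margin {y : ℝ} (hy : y * y = 1) (C α t : ℝ) :
    -α * (y * t) - C * max (1 - y * (y * t)) 0 = -(α * y) * t - C * max (1 - t) 0 := by
  rw [← mul_assoc y y t, hy, one_mul]
  ring

theorem hinge_conjugate_objective_le {a C : ℝ} (ha : 0 ≤ a) (haC : a ≤ C) (t : ℝ) :
    -a * t - C * max (1 - t) 0 ≤ -a := by
  have h₁ : a * (1 - t) ≤ a * max (1 - t) 0 :=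
    mul_le_mul_of_nonneg_left (le_max_left _ _) ha
  have h₂ : a * max (1 - t) 0 ≤ C * max (1 - t) 0 :=
    mul_le_mul_of_nonneg_right haC (le_max_right _ _)
  linarith

theorem exists_lt_hinge_conjugate_objective {a C : ℝ} (h : a < 0 ∨ C < a) (b : ℝ) :
    ∃ t : ℝ, b < -a * t - C * max (1 - t) 0 := by
  rcases h with h | h
  · have hs : 0 ≤ (|b| + 1) / -a := div_nonneg (by positivity) (by linarith)
    have hmul : -a * ((|b| + 1) / -a) = |b| + 1 := mul_div_cancel₀ _ (by linarith)
    refine ⟨1 + (|b| + 1) / -a, ?_⟩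
    rw [max_eq_right (by linarith)]
    linarith [le_abs_self b]
  · have hs : 0 ≤ (|b + a| + 1) / (a - C) := div_nonneg (by positivity) (by linarith)
    have hmul : (a - C) * ((|b + a| + 1) / (a - C)) = |b + a| + 1 :=
      mul_div_cancel₀ _ (by linarith)
    refine ⟨1 - (|b + a| + 1) / (a - C), ?_⟩
    rw [max_eq_left (by linarith)]
    linarith [le_abs_self (b + a)]

/-- Convex conjugate of the hinge (L1) loss `ξ(z) = C·max(1 - yz, 0)`: the function
`z ↦ -αz - ξ(z)` is bounded above with supremum `-αy` when `0 ≤ αy ≤ C`, and is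
unbounded above otherwise. -/
theorem hinge_loss_conjugate
    (y C α : ℝ) (hy : y = 1 ∨ y = -1) (hC : 0 < C) :
    ((0 ≤ α * y ∧ α * y ≤ C) →
      BddAbove (Set.range fun z : ℝ => -α * z - C * max (1 - y * z) 0) ∧
        sSup (Set.range fun z : ℝ => -α * z - C * max (1 - y * z) 0) = -α * y) ∧
    ((α * y < 0 ∨ C < α * y) →
      ¬ BddAbove (Set.range fun z : ℝ => -α * z - C * max (1 - y * z) 0)) := by
  have hyy : y * y = 1 := by rcases hy with rfl | rfl <;> norm_num
  have objective_eq := hinge_conjugate_objective_at_margin hyy C α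
  constructor
  · rintro ⟨h₀, h₁⟩
    have hmax : IsGreatest (Set.range fun z : ℝ => -α * z - C * max (1 - y * z) 0) (-α * y) := by
      constructor
      · exact ⟨y, by simp [hyy]⟩
      · rintro _ ⟨z, rfl⟩
        have hz : y * (y * z) = z := by rw [← mul_assoc, hyy, one_mul]
        have hle := hinge_conjugate_objective_le h₀ h₁ (y * z)
        rw [← objective_eq, hz] at hle
        simpa only [neg_mul] using hle
    exact ⟨hmax.bddAbove, hmax.csSup_eq⟩
  · rintro h ⟨b, hb⟩
    obtain ⟨t, ht⟩ := exists_lt_hinge_conjugate_objective h b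
    rw [← objective_eq] at ht
    exact (hb ⟨y * t, rfl⟩).not_gt ht
end

section
/- Let y ∈ ℝ with y = 1 or y = -1, let C > 0, and let α ∈ ℝ. If α·y ≥ 0, then the function z ↦ -α·z - C·(max(1 - y·z, 0))² on ℝ is bounded above and its supremum equals -α·y + α²/(4C). If instead α·y < 0, this function is unbounded above. -/
/-- For `y² = 1` and `αy ≥ 0`, the supremum defining the conjugate of the squared-hinge loss
is attained, at `z = y - α / (2C)`. -/
theorem isGreatest_range_sub_squared_hinge {y C α : ℝ} (hy : y * y = 1) (hC : 0 < C)
    (h : 0 ≤ α * y) :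
    IsGreatest (Set.range fun z : ℝ => -α * z - C * (max (1 - y * z) 0) ^ 2)
      (-α * y + α ^ 2 / (4 * C)) := by
  constructor
  · refine ⟨y - α / (2 * C), ?_⟩
    have hmargin : 1 - y * (y - α / (2 * C)) = α * y / (2 * C) := by
      linear_combination -hy
    have hmax : max (1 - y * (y - α / (2 * C))) 0 = α * y / (2 * C) := by
      rw [hmargin]
      exact max_eq_left (by positivity)
    simp only [hmax]
    field_simp
    linear_combination -4 * α ^ 2 * hy
  · rintro _ ⟨z, rfl⟩
    have hlin : α * y * (1 - y * z) ≤ α * y * max (1 - y * z) 0 :=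
      mul_le_mul_of_nonneg_left (le_max_left _ _) h
    have hlin_eq : α * y * (1 - y * z) = α * y - α * z := by
      linear_combination -α * z * hy
    beta_reduce
    generalize max (1 - y * z) 0 = m at hlin ⊢
    have hquad : α * y * m - C * m ^ 2 ≤ α ^ 2 / (4 * C) := by
      rw [le_div_iff₀ (by positivity)]
      have hsq : (α * y) ^ 2 = α ^ 2 := by linear_combination α ^ 2 * hy
      linarith [sq_nonneg (α * y - 2 * C * m)]
    linarith

/-- For `y² = 1` and `αy < 0`, the conjugate of the squared-hinge loss is infinite. -/
theorem not_bddAbove_range_sub_squared_hinge {y C α : ℝ} (hy : y * y = 1) (h : α * y < 0) :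
    ¬ BddAbove (Set.range fun z : ℝ => -α * z - C * (max (1 - y * z) 0) ^ 2) := by
  rintro ⟨M, hM⟩
  have hpos : 0 < -(α * y) := neg_pos.mpr h
  have hnonneg : 0 ≤ |M| / -(α * y) := by positivity
  have hmax : max (1 - y * (y * (1 + |M| / -(α * y)))) 0 = 0 :=
    max_eq_right (by rw [← mul_assoc, hy]; linarith)
  have hle := hM ⟨y * (1 + |M| / -(α * y)), rfl⟩
  simp only [hmax] at hle
  have hcancel : |M| / -(α * y) * -(α * y) = |M| := div_mul_cancel₀ _ hpos.ne'
  linarith [le_abs_self M]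

/-- Convex conjugate of the squared-hinge (L2) loss `ξ(z) = C·(max(1 - yz, 0))²`: the
function `z ↦ -αz - ξ(z)` is bounded above with supremum `-αy + α²/(4C)` when
`αy ≥ 0`, and is unbounded above when `αy < 0`. -/
theorem squared_hinge_loss_conjugate
    (y C α : ℝ) (hy : y = 1 ∨ y = -1) (hC : 0 < C) :
    ((0 ≤ α * y) →
      BddAbove (Set.range fun z : ℝ => -α * z - C * (max (1 - y * z) 0) ^ 2) ∧
        sSup (Set.range fun z : ℝ => -α * z - C * (max (1 - y * z) 0) ^ 2) =
          -α * y + α ^ 2 / (4 * C)) ∧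
    ((α * y < 0) →
      ¬ BddAbove (Set.range fun z : ℝ => -α * z - C * (max (1 - y * z) 0) ^ 2)) := by
  have hyy : y * y = 1 := by rcases hy with rfl | rfl <;> norm_num
  refine ⟨fun h => ?_, not_bddAbove_range_sub_squared_hinge hyy⟩
  have hmax := isGreatest_range_sub_squared_hinge hyy hC h
  exact ⟨hmax.bddAbove, hmax.csSup_eq⟩
end
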